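/- Let p > 3, set z* = (1/(p−1))^(1/(p−2)) and t*(p) = ((8 + p(2p−7))/((p−1)(3p−4)))^(1/(p−2)). If τ ∈ (z*, t*(p)) satisfies g(τ) = 0, then g'(τ) > 0 (where g' denotes the derivative of g). -/

import Mathlib

/-- `f(t) = t²/2 - tᵖ/p`. -/
noncomputable def f (p t : ℝ) : ℝ := t ^ 2 / 2 - t ^ p / p

/-- First derivative: `f'(t) = t - t^(p-1)`. -/
noncomputable def f' (p t : ℝ) : ℝ := t - t ^ (p - 1)

/-- Second derivative: `f''(t) = 1 - (p-1) t^(p-2)`. -/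
noncomputable def f'' (p t : ℝ) : ℝ := 1 - (p - 1) * t ^ (p - 2)

/-- Third derivative: `f'''(t) = -(p-1)(p-2) t^(p-3)`. -/
noncomputable def f''' (p t : ℝ) : ℝ := -(p - 1) * (p - 2) * t ^ (p - 3)

/-- `g(t) = -3 f''(t) f'(t)² + 6 (f(t)-f(1)) f''(t)² - 2 (f(t)-f(1)) f'''(t) f'(t)`. -/
noncomputable def g (p t : ℝ) : ℝ :=
  -3 * f'' p t * (f' p t) ^ 2 + 6 * (f p t - f p 1) * (f'' p t) ^ 2
    - 2 * (f p t - f p 1) * f''' p t * f' p t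

/-- Fourth derivative of `f p`. -/
noncomputable def fourthDeriv (p t : ℝ) : ℝ := -(p - 1) * (p - 2) * (p - 3) * t ^ (p - 4)

lemma hasDerivAt_f {p t : ℝ} (hp : p ≠ 0) (ht : 0 < t) : HasDerivAt (f p) (f' p t) t := by
  have h := ((hasDerivAt_pow 2 t).div_const 2).sub
    ((Real.hasDerivAt_rpow_const (p := p) (Or.inl ht.ne')).div_const p)
  refine h.congr_deriv ?_
  simp only [f']
  field_simp
  norm_num
  ring

lemma hasDerivAt_f' {p t : ℝ} (ht : 0 < t) : HasDerivAt (f' p) (f'' p t) t := by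
  have h := (hasDerivAt_id t).sub
    (Real.hasDerivAt_rpow_const (p := p - 1) (Or.inl ht.ne'))
  refine h.congr_deriv ?_
  rw [f'', show p - 1 - 1 = p - 2 by ring]

lemma hasDerivAt_f'' {p t : ℝ} (ht : 0 < t) : HasDerivAt (f'' p) (f''' p t) t := by
  have h := ((Real.hasDerivAt_rpow_const (p := p - 2) (Or.inl ht.ne')).const_mul
    (p - 1)).const_sub 1
  refine h.congr_deriv ?_
  rw [f''', show p - 2 - 1 = p - 3 by ring]
  ring

lemma hasDerivAt_f''' {p t : ℝ} (ht : 0 < t) : HasDerivAt (f''' p) (fourthDeriv p t) t := by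
  have h := (Real.hasDerivAt_rpow_const (p := p - 3) (Or.inl ht.ne')).const_mul
    (-(p - 1) * (p - 2))
  refine h.congr_deriv ?_
  rw [fourthDeriv, show p - 3 - 1 = p - 4 by ring]
  ring

lemma hasDerivAt_g {p t : ℝ} (hp : p ≠ 0) (ht : 0 < t) :
    HasDerivAt (g p)
      (-5 * f''' p t * f' p t ^ 2
        + (f p t - f p 1) * (10 * f'' p t * f''' p t - 2 * fourthDeriv p t * f' p t)) t := by
  have h0 := (hasDerivAt_f hp ht).sub_const (f p 1)
  have h1 := hasDerivAt_f' (p := p) ht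
  have h2 := hasDerivAt_f'' (p := p) ht
  have h3 := hasDerivAt_f''' (p := p) ht
  have h := (((h2.const_mul (-3)).mul (h1.pow 2)).add ((h0.const_mul 6).mul (h2.pow 2))).sub
    (((h0.const_mul 2).mul h3).mul h1)
  refine h.congr_deriv ?_
  simp only [Pi.mul_apply, Pi.pow_apply]
  push_cast
  ring

/-- The combination of derivatives of `f` governing the sign of `g'` at the zeros of `g`. -/
lemma five_mul_sq_sub_pos {p t : ℝ} (hp : 3 < p) (ht : 0 < t) :
    0 < 5 * f''' p t ^ 2 - 3 * f'' p t * fourthDeriv p t := by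
  have e3 : t ^ (p - 3) = t ^ (p - 4) * t := by
    rw [← Real.rpow_add_one ht.ne']; ring_nf
  have e2 : t ^ (p - 2) = t ^ (p - 4) * t * t := by
    rw [← e3, ← Real.rpow_add_one ht.ne']; ring_nf
  have h1 : 0 < p - 1 := by linarith
  have h2 : 0 < p - 2 := by linarith
  have h3 : 0 < p - 3 := by linarith
  have h4 : 0 < 2 * p - 1 := by linarith
  have key : 0 < (p - 1) * (p - 2) * t ^ (p - 4) *
      ((p - 1) * (2 * p - 1) * (t ^ (p - 4) * t * t) + 3 * (p - 3)) := by positivity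
  rw [f'', f''', fourthDeriv, e2, e3]
  linear_combination key

lemma deriv_g_pos_of_g_eq_zero {p t : ℝ} (hp : 3 < p) (ht : 0 < t) (ht1 : t < 1)
    (hg : g p t = 0) : 0 < deriv (g p) t := by
  rw [(hasDerivAt_g (by linarith) ht).deriv]
  have hf' : 0 < f' p t := by
    have := Real.rpow_lt_rpow_of_exponent_gt ht ht1 (show 1 < p - 1 by linarith)
    rw [Real.rpow_one] at this
    rw [f']
    linarith
  have hf''' : 0 < -f''' p t := by
    have h1 : 0 < p - 1 := by linarith
    have h2 : 0 < p - 2 := by linarith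
    have : 0 < (p - 1) * (p - 2) * t ^ (p - 3) := by positivity
    rw [f''']
    linarith
  have hQ : 0 < 6 * f'' p t ^ 2 + 2 * (-f''' p t) * f' p t := by positivity
  refine pos_of_mul_pos_right (a := 6 * f'' p t ^ 2 + 2 * (-f''' p t) * f' p t) ?_ hQ.le
  have key : 0 < 2 * f' p t ^ 3 * (5 * f''' p t ^ 2 - 3 * f'' p t * fourthDeriv p t) :=
    mul_pos (by positivity) (five_mul_sq_sub_pos hp ht)
  rw [g] at hg
  refine key.trans_eq ?_
  linear_combination (-10 * f'' p t * f''' p t + 2 * fourthDeriv p t * f' p t) * hg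

/-- let `p > 3`, `z* = (1/(p-1))^(1/(p-2))` and
`t*(p) = ((8+p(2p-7))/((p-1)(3p-4)))^(1/(p-2))`. If `τ ∈ (z*, t*(p))` and `g(τ) = 0`,
then `g'(τ) > 0`. -/
theorem stmt_13 (p : ℝ) (hp : 3 < p) (τ : ℝ)
    (hτ : τ ∈ Set.Ioo ((1 / (p - 1)) ^ (1 / (p - 2)))
      (((8 + p * (2 * p - 7)) / ((p - 1) * (3 * p - 4))) ^ (1 / (p - 2))))
    (hg : g p τ = 0) :
    0 < deriv (g p) τ := by
  have h1 : 0 < p - 1 := by linarith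
  have h34 : 0 < 3 * p - 4 := by linarith
  have hτ0 : 0 < τ := lt_of_le_of_lt (by positivity) hτ.1
  have hτ1 : τ < 1 := by
    refine hτ.2.trans_le (Real.rpow_le_one ?_ ?_ ?_)
    · exact div_nonneg (by nlinarith) (by positivity)
    · rw [div_le_one (by positivity)]
      nlinarith
    · exact one_div_nonneg.2 (by linarith)
  exact deriv_g_pos_of_g_eq_zero hp hτ0 hτ1 hg
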